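/- arXiv:1505.03564 — 10 statements merged into one kernel-verified Lean document; each statement's English description precedes it below -/
import Mathlib

section
/- If δ > 0, δ₁ > 0, δ₂ > 0, δ₃ > 0, δ₄ > 0, then D > 0 and the five segment lengths of the Steiner tree are |S₁ − P₁| = δ₁/√D, |S₁ − P₂| = δ₂/√D, |S₂ − P₃| = δ₃/√D, |S₂ − P₄| = δ₄/√D, and |S₁ − S₂| = δ/√D. -/
theorem dist_aux (A B : EuclideanSpace ℝ (Fin 2)) (u v d D c : ℝ) (hD : 0 < D) (hd : 0 < d)
    (hc : c ^ 2 * (u ^ 2 + v ^ 2) * D = 1)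
    (h0 : A 0 - B 0 = c * d * u) (h1 : A 1 - B 1 = c * d * v) :
    dist A B = d / Real.sqrt D := by
  rw [EuclideanSpace.dist_eq, Fin.sum_univ_two, Real.dist_eq, Real.dist_eq, sq_abs, sq_abs, h0, h1,
    Real.sqrt_eq_iff_mul_self_eq (by positivity) (by positivity), div_mul_div_comm,
    Real.mul_self_sqrt hD.le, eq_div_iff hD.ne']
  linear_combination d ^ 2 * hc

theorem steiner_tree_segment_lengths
    (x₁ y₁ x₂ y₂ x₃ y₃ x₄ y₄ : ℝ)
    (P₁ P₂ P₃ P₄ S₁ S₂ : EuclideanSpace ℝ (Fin 2))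
    (hP₁ : P₁ = ![x₁, y₁]) (hP₂ : P₂ = ![x₂, y₂])
    (hP₃ : P₃ = ![x₃, y₃]) (hP₄ : P₄ = ![x₄, y₄])
    (τ₁ τ₂ η₁ η₂ δ δ₁ δ₂ δ₃ δ₄ D : ℝ)
    (hτ₁ : τ₁ = 2*x₁ - x₂ - 2*x₃ + x₄ + Real.sqrt 3 * (y₂ - y₄))
    (hτ₂ : τ₂ = -x₁ + 2*x₂ + x₃ - 2*x₄ + Real.sqrt 3 * (y₃ - y₁))
    (hη₁ : η₁ = -(τ₁ + 2*τ₂) / Real.sqrt 3)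
    (hη₂ : η₂ = (2*τ₁ + τ₂) / Real.sqrt 3)
    (hδ : δ = -(x₁ - x₃) * η₁ + (y₁ - y₃) * τ₁)
    (hδ₁ : δ₁ = (x₁ - x₂) * η₂ - (y₁ - y₂) * τ₂)
    (hδ₂ : δ₂ = (x₁ - x₂) * η₁ - (y₁ - y₂) * τ₁)
    (hδ₃ : δ₃ = -(x₃ - x₄) * η₂ + (y₃ - y₄) * τ₂)
    (hδ₄ : δ₄ = -(x₃ - x₄) * η₁ + (y₃ - y₄) * τ₁)
    (hD : D = τ₁^2 + τ₁*τ₂ + τ₂^2)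
    (hS₁ : S₁ = ![x₁ - Real.sqrt 3 / 2 * (δ₁ * τ₁ / D), y₁ - Real.sqrt 3 / 2 * (δ₁ * η₁ / D)])
    (hS₂ : S₂ = ![x₃ + Real.sqrt 3 / 2 * (δ₃ * τ₁ / D), y₃ + Real.sqrt 3 / 2 * (δ₃ * η₁ / D)])
    (h : 0 < δ) (h1 : 0 < δ₁) (h2 : 0 < δ₂) (h3 : 0 < δ₃) (h4 : 0 < δ₄) :
    0 < D
    ∧ dist S₁ P₁ = δ₁ / Real.sqrt D
    ∧ dist S₁ P₂ = δ₂ / Real.sqrt D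
    ∧ dist S₂ P₃ = δ₃ / Real.sqrt D
    ∧ dist S₂ P₄ = δ₄ / Real.sqrt D
    ∧ dist S₁ S₂ = δ / Real.sqrt D := by
  obtain ⟨s, hs⟩ : ∃ s, s = Real.sqrt 3 := ⟨_, rfl⟩
  have hs2 : s ^ 2 = 3 := by rw [hs]; exact Real.sq_sqrt (by norm_num)
  have hs0 : s ≠ 0 := by rintro rfl; norm_num at hs2
  rw [← hs] at hτ₁ hτ₂ hη₁ hη₂ hS₁ hS₂
  have e1 : s * η₁ = -(τ₁ + 2*τ₂) := by rw [hη₁]; field_simp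
  have e2 : s * η₂ = 2*τ₁ + τ₂ := by rw [hη₂]; field_simp
  have f1 : η₁ = -(s * (x₂ - x₄) + (y₂ - y₄) - 2 * (y₁ - y₃)) := by
    apply mul_left_cancel₀ hs0
    rw [e1, hτ₁, hτ₂]
    linear_combination (x₂ - x₄) * hs2
  have f2 : η₂ = s * (x₁ - x₃) + 2 * (y₂ - y₄) - (y₁ - y₃) := by
    apply mul_left_cancel₀ hs0
    rw [e2, hτ₁, hτ₂]
    linear_combination (-(x₁ - x₃)) * hs2
  have L : δ + δ₁ + δ₃ = (x₁ - x₃) * η₂ - (y₁ - y₃) * τ₂ := by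
    rw [hδ, hδ₁, hδ₃, f1, f2, hτ₁, hτ₂]; ring
  have hDpos : 0 < D := by
    rcases eq_or_ne τ₁ 0 with a | a
    · rcases eq_or_ne τ₂ 0 with b | b
      · exfalso
        have : η₁ = 0 := by rw [hη₁, a, b]; simp
        rw [hδ, this, a] at h
        simp at h
      · have : 0 < τ₂ ^ 2 := by positivity
        rw [hD, a]; linarith
    · have : 0 < τ₁ ^ 2 := by positivity
      nlinarith [sq_nonneg (τ₁ + 2 * τ₂)]
  have hD0 := hDpos.ne'
  have g1 : 3 * η₁ ^ 2 = (τ₁ + 2*τ₂) ^ 2 := by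
    linear_combination (-η₁ ^ 2) * hs2 + (s * η₁ - (τ₁ + 2*τ₂)) * e1
  have g2 : 3 * η₂ ^ 2 = (2*τ₁ + τ₂) ^ 2 := by
    linear_combination (-η₂ ^ 2) * hs2 + (s * η₂ + (2*τ₁ + τ₂)) * e2
  have g12 : 3 * (η₁ * η₂) = -(τ₁ + 2*τ₂) * (2*τ₁ + τ₂) := by
    linear_combination (-η₁ * η₂) * hs2 + (s * η₂) * e1 - (τ₁ + 2*τ₂) * e2
  have W : s * (η₂ * τ₁ - η₁ * τ₂) = 2 * D := by
    rw [hD]; linear_combination τ₁ * e2 - τ₂ * e1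
  have n1 : 3 * (τ₁ ^ 2 + η₁ ^ 2) = 4 * D := by rw [hD]; linear_combination g1
  have n2 : 3 * (τ₂ ^ 2 + η₂ ^ 2) = 4 * D := by rw [hD]; linear_combination g2
  have n3 : 3 * ((τ₁ + τ₂) ^ 2 + (η₁ + η₂) ^ 2) = 4 * D := by
    rw [hD]; linear_combination g1 + g2 + 2 * g12
  have c1 : ∀ u v : ℝ, 3 * (u ^ 2 + v ^ 2) = 4 * D → (s / (2 * D)) ^ 2 * (u ^ 2 + v ^ 2) * D = 1 := by
    intro u v huv
    rw [div_pow, hs2]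
    field_simp
    linear_combination huv
  have c2 : ∀ u v : ℝ, 3 * (u ^ 2 + v ^ 2) = 4 * D →
      (-(s / (2 * D))) ^ 2 * (u ^ 2 + v ^ 2) * D = 1 := by
    intro u v huv
    rw [neg_sq]; exact c1 u v huv
  refine ⟨hDpos, dist_aux _ _ τ₁ η₁ _ D _ hDpos h1 (c2 _ _ n1) ?_ ?_,
    dist_aux _ _ τ₂ η₂ _ D _ hDpos h2 (c2 _ _ n2) ?_ ?_,
    dist_aux _ _ τ₁ η₁ _ D _ hDpos h3 (c1 _ _ n1) ?_ ?_,
    dist_aux _ _ τ₂ η₂ _ D _ hDpos h4 (c1 _ _ n2) ?_ ?_,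
    dist_aux _ _ (τ₁ + τ₂) (η₁ + η₂) _ D _ hDpos h (c1 _ _ n3) ?_ ?_⟩ <;>
    simp only [hS₁, hS₂, hP₁, hP₂, hP₃, hP₄, Matrix.cons_val_zero, Matrix.cons_val_one] <;>
    field_simp
  · ring
  · ring
  · rw [hδ₁, hδ₂]; linear_combination (-(x₁ - x₂)) * W
  · rw [hδ₁, hδ₂]; linear_combination (-(y₁ - y₂)) * W
  · ring
  · ring
  · rw [hδ₃, hδ₄]; linear_combination (-(x₃ - x₄)) * W
  · rw [hδ₃, hδ₄]; linear_combination (-(y₃ - y₄)) * W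
  · linear_combination (-(x₁ - x₃)) * W - s * τ₁ * L - s * τ₂ * hδ
  · linear_combination (-(y₁ - y₃)) * W - s * η₁ * L - s * η₂ * hδ
end

section
/- If D ≠ 0, then the difference of the two Steiner points satisfies S₁ − S₂ = ((√3/2)·(τ₁ + τ₂)δ/D, (1/2)·(τ₁ − τ₂)δ/D). -/
theorem steiner_points_difference
    (x₁ y₁ x₂ y₂ x₃ y₃ x₄ y₄ : ℝ)
    (P₁ P₂ P₃ P₄ S₁ S₂ : EuclideanSpace ℝ (Fin 2))
    (hP₁ : P₁ = ![x₁, y₁]) (hP₂ : P₂ = ![x₂, y₂])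
    (hP₃ : P₃ = ![x₃, y₃]) (hP₄ : P₄ = ![x₄, y₄])
    (τ₁ τ₂ η₁ η₂ δ δ₁ δ₂ δ₃ δ₄ D : ℝ)
    (hτ₁ : τ₁ = 2*x₁ - x₂ - 2*x₃ + x₄ + Real.sqrt 3 * (y₂ - y₄))
    (hτ₂ : τ₂ = -x₁ + 2*x₂ + x₃ - 2*x₄ + Real.sqrt 3 * (y₃ - y₁))
    (hη₁ : η₁ = -(τ₁ + 2*τ₂) / Real.sqrt 3)
    (hη₂ : η₂ = (2*τ₁ + τ₂) / Real.sqrt 3)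
    (hδ : δ = -(x₁ - x₃) * η₁ + (y₁ - y₃) * τ₁)
    (hδ₁ : δ₁ = (x₁ - x₂) * η₂ - (y₁ - y₂) * τ₂)
    (hδ₂ : δ₂ = (x₁ - x₂) * η₁ - (y₁ - y₂) * τ₁)
    (hδ₃ : δ₃ = -(x₃ - x₄) * η₂ + (y₃ - y₄) * τ₂)
    (hδ₄ : δ₄ = -(x₃ - x₄) * η₁ + (y₃ - y₄) * τ₁)
    (hD : D = τ₁^2 + τ₁*τ₂ + τ₂^2)
    (hS₁ : S₁ = ![x₁ - Real.sqrt 3 / 2 * (δ₁ * τ₁ / D), y₁ - Real.sqrt 3 / 2 * (δ₁ * η₁ / D)])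
    (hS₂ : S₂ = ![x₃ + Real.sqrt 3 / 2 * (δ₃ * τ₁ / D), y₃ + Real.sqrt 3 / 2 * (δ₃ * η₁ / D)])
    (hD0 : D ≠ 0) :
    S₁ - S₂ = ![Real.sqrt 3 / 2 * ((τ₁ + τ₂) * δ / D),
                (1/2) * ((τ₁ - τ₂) * δ / D)] := by
  have hs0 : Real.sqrt 3 ≠ 0 := by positivity
  have e1 : Real.sqrt 3 * η₁ = -(τ₁ + 2*τ₂) := by rw [hη₁]; field_simp
  have e2 : Real.sqrt 3 * η₂ = 2*τ₁ + τ₂ := by rw [hη₂]; field_simp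
  have d : Real.sqrt 3 * δ = (x₁ - x₃) * (τ₁ + 2*τ₂) + Real.sqrt 3 * (y₁ - y₃) * τ₁ := by
    rw [hδ]; linear_combination (-(x₁ - x₃)) * e1
  have d13 : Real.sqrt 3 * (δ₁ + δ₃) = (x₁ - x₂ - x₃ + x₄) * (2*τ₁ + τ₂)
      - Real.sqrt 3 * (y₁ - y₂ - y₃ + y₄) * τ₂ := by
    rw [hδ₁, hδ₃]; linear_combination (x₁ - x₂ - x₃ + x₄) * e2
  have key : τ₁ * (-(x₁ - x₃) + 2 * (x₂ - x₄) - Real.sqrt 3 * (y₁ - y₃))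
      - τ₂ * (2 * (x₁ - x₃) - (x₂ - x₄) + Real.sqrt 3 * (y₂ - y₄)) = 0 := by
    linear_combination τ₂ * hτ₁ - τ₁ * hτ₂
  have hx : (x₁ - x₃) * D - Real.sqrt 3 / 2 * (δ₁ + δ₃) * τ₁
      = Real.sqrt 3 / 2 * ((τ₁ + τ₂) * δ) := by
    rw [hD]
    linear_combination (-τ₁ / 2) * d13 - ((τ₁ + τ₂) / 2) * d + (τ₁ / 2) * key
  have hy : (y₁ - y₃) * D - Real.sqrt 3 / 2 * (δ₁ + δ₃) * η₁
      = 1 / 2 * ((τ₁ - τ₂) * δ) := by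
    apply mul_left_cancel₀ hs0
    rw [hD]
    linear_combination (-(Real.sqrt 3 * (δ₁ + δ₃)) / 2) * e1 + ((τ₁ + 2 * τ₂) / 2) * d13
      - ((τ₁ - τ₂) / 2) * d - ((τ₁ + 2 * τ₂) / 2) * key
  have hx' : x₁ - Real.sqrt 3 / 2 * (δ₁ * τ₁ / D) - (x₃ + Real.sqrt 3 / 2 * (δ₃ * τ₁ / D))
      = Real.sqrt 3 / 2 * ((τ₁ + τ₂) * δ / D) := by
    rw [← mul_div_assoc (Real.sqrt 3 / 2) ((τ₁ + τ₂) * δ), ← hx]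
    field_simp
    ring
  have hy' : y₁ - Real.sqrt 3 / 2 * (δ₁ * η₁ / D) - (y₃ + Real.sqrt 3 / 2 * (δ₃ * η₁ / D))
      = (1/2) * ((τ₁ - τ₂) * δ / D) := by
    rw [← mul_div_assoc (1 / 2 : ℝ) ((τ₁ - τ₂) * δ), ← hy]
    field_simp
    ring
  rw [← hx', ← hy']
  ext i
  fin_cases i <;> simp [hS₁, hS₂]
end

section
/- If δ > 0, δ₁ > 0, δ₂ > 0, δ₃ > 0, δ₄ > 0, then the total length of the Steiner tree of topology P₁,P₂—S₁—S₂—P₃,P₄ equals √(D/3): |P₁ − S₁| + |P₂ − S₁| + |S₁ − S₂| + |P₃ − S₂| + |P₄ − S₂| = √((τ₁² + τ₁τ₂ + τ₂²)/3). -/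
lemma steiner_alg (x₁ y₁ x₂ y₂ q a b : ℝ) (hq : q ^ 2 = 3) :
    (2 * (a^2 + a*b + b^2) * (x₂ - x₁) =
      q * (((x₁ - x₂) * (-(a + 2*b) * q / 3) - (y₁ - y₂) * a) * b
        - ((x₁ - x₂) * ((2*a + b) * q / 3) - (y₁ - y₂) * b) * a)) ∧
    (2 * (a^2 + a*b + b^2) * (y₂ - y₁) =
      q * (((x₁ - x₂) * (-(a + 2*b) * q / 3) - (y₁ - y₂) * a) * ((2*a + b) * q / 3)
        - ((x₁ - x₂) * ((2*a + b) * q / 3) - (y₁ - y₂) * b) * (-(a + 2*b) * q / 3))) := by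
  constructor
  · linear_combination 2 / 3 * (x₁ - x₂) * (a^2 + a*b + b^2) * hq
  · linear_combination 2 / 3 * (y₁ - y₂) * (a^2 + a*b + b^2) * hq

lemma steiner_alg2 (x₁ y₁ x₂ y₂ x₃ y₃ x₄ y₄ q a b : ℝ) (hq : q ^ 2 = 3)
    (ha : a = 2*x₁ - x₂ - 2*x₃ + x₄ + q * (y₂ - y₄))
    (hb : b = -x₁ + 2*x₂ + x₃ - 2*x₄ + q * (y₃ - y₁)) :
    (2 * (a^2 + a*b + b^2) * (x₁ - x₃) =
      q * (((x₁ - x₂) * ((2*a + b) * q / 3) - (y₁ - y₂) * b) * a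
        + (-(x₃ - x₄) * ((2*a + b) * q / 3) + (y₃ - y₄) * b) * a
        + (-(x₁ - x₃) * (-(a + 2*b) * q / 3) + (y₁ - y₃) * a) * (a + b))) ∧
    (2 * (a^2 + a*b + b^2) * (y₁ - y₃) =
      q * (((x₁ - x₂) * ((2*a + b) * q / 3) - (y₁ - y₂) * b) * (-(a + 2*b) * q / 3)
        + (-(x₃ - x₄) * ((2*a + b) * q / 3) + (y₃ - y₄) * b) * (-(a + 2*b) * q / 3)
        + (-(x₁ - x₃) * (-(a + 2*b) * q / 3) + (y₁ - y₃) * a)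
          * (-(a + 2*b) * q / 3 + (2*a + b) * q / 3))) ∧
    q * (((x₁ - x₂) * ((2*a + b) * q / 3) - (y₁ - y₂) * b)
      + ((x₁ - x₂) * (-(a + 2*b) * q / 3) - (y₁ - y₂) * a)
      + (-(x₁ - x₃) * (-(a + 2*b) * q / 3) + (y₁ - y₃) * a)
      + (-(x₃ - x₄) * ((2*a + b) * q / 3) + (y₃ - y₄) * b)
      + (-(x₃ - x₄) * (-(a + 2*b) * q / 3) + (y₃ - y₄) * a)) = (a^2 + a*b + b^2) := by
  refine ⟨?_, ?_, ?_⟩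
  · subst ha hb; grind
  · subst ha hb; grind
  · subst ha hb; grind

lemma steiner_edge (P S : EuclideanSpace ℝ (Fin 2)) (k d u v D : ℝ) (hD : 0 < D) (hd : 0 < d)
    (hk : k = Real.sqrt 3 / (2 * D)) (huv : u ^ 2 + v ^ 2 = 4 / 3 * D)
    (hx : P 0 - S 0 = k * d * u ∨ P 0 - S 0 = -(k * d * u))
    (hy : P 1 - S 1 = k * d * v ∨ P 1 - S 1 = -(k * d * v)) :
    dist P S = d / Real.sqrt D := by
  have hq : Real.sqrt 3 ^ 2 = 3 := Real.sq_sqrt (by norm_num)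
  have hx2 : (P 0 - S 0) ^ 2 = (k * d * u) ^ 2 := by rcases hx with h | h <;> rw [h] <;> ring
  have hy2 : (P 1 - S 1) ^ 2 = (k * d * v) ^ 2 := by rcases hy with h | h <;> rw [h] <;> ring
  rw [EuclideanSpace.dist_eq, Fin.sum_univ_two, Real.dist_eq, Real.dist_eq, sq_abs, sq_abs,
    hx2, hy2]
  have : (k * d * u) ^ 2 + (k * d * v) ^ 2 = d ^ 2 / D := by
    have e : (k * d * u) ^ 2 + (k * d * v) ^ 2 = k ^ 2 * d ^ 2 * (u ^ 2 + v ^ 2) := by ring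
    rw [e, huv, hk, div_pow, hq]
    field_simp
    norm_num
  rw [this, Real.sqrt_div (sq_nonneg d), Real.sqrt_sq hd.le]

theorem steiner_tree_total_length
    (x₁ y₁ x₂ y₂ x₃ y₃ x₄ y₄ : ℝ)
    (P₁ P₂ P₃ P₄ S₁ S₂ : EuclideanSpace ℝ (Fin 2))
    (hP₁ : P₁ = ![x₁, y₁]) (hP₂ : P₂ = ![x₂, y₂])
    (hP₃ : P₃ = ![x₃, y₃]) (hP₄ : P₄ = ![x₄, y₄])
    (τ₁ τ₂ η₁ η₂ δ δ₁ δ₂ δ₃ δ₄ D : ℝ)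
    (hτ₁ : τ₁ = 2*x₁ - x₂ - 2*x₃ + x₄ + Real.sqrt 3 * (y₂ - y₄))
    (hτ₂ : τ₂ = -x₁ + 2*x₂ + x₃ - 2*x₄ + Real.sqrt 3 * (y₃ - y₁))
    (hη₁ : η₁ = -(τ₁ + 2*τ₂) / Real.sqrt 3)
    (hη₂ : η₂ = (2*τ₁ + τ₂) / Real.sqrt 3)
    (hδ : δ = -(x₁ - x₃) * η₁ + (y₁ - y₃) * τ₁)
    (hδ₁ : δ₁ = (x₁ - x₂) * η₂ - (y₁ - y₂) * τ₂)
    (hδ₂ : δ₂ = (x₁ - x₂) * η₁ - (y₁ - y₂) * τ₁)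
    (hδ₃ : δ₃ = -(x₃ - x₄) * η₂ + (y₃ - y₄) * τ₂)
    (hδ₄ : δ₄ = -(x₃ - x₄) * η₁ + (y₃ - y₄) * τ₁)
    (hD : D = τ₁^2 + τ₁*τ₂ + τ₂^2)
    (hS₁ : S₁ = ![x₁ - Real.sqrt 3 / 2 * (δ₁ * τ₁ / D), y₁ - Real.sqrt 3 / 2 * (δ₁ * η₁ / D)])
    (hS₂ : S₂ = ![x₃ + Real.sqrt 3 / 2 * (δ₃ * τ₁ / D), y₃ + Real.sqrt 3 / 2 * (δ₃ * η₁ / D)])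
    (h : 0 < δ) (h1 : 0 < δ₁) (h2 : 0 < δ₂) (h3 : 0 < δ₃) (h4 : 0 < δ₄) :
    dist P₁ S₁ + dist P₂ S₁ + dist S₁ S₂ + dist P₃ S₂ + dist P₄ S₂
      = Real.sqrt ((τ₁^2 + τ₁*τ₂ + τ₂^2) / 3) := by
  have hq : Real.sqrt 3 ^ 2 = 3 := Real.sq_sqrt (by norm_num)
  have hq0 : 0 < Real.sqrt 3 := Real.sqrt_pos.mpr (by norm_num)
  have e1 : η₁ = -(τ₁ + 2*τ₂) * Real.sqrt 3 / 3 := by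
    rw [hη₁, div_eq_div_iff hq0.ne' (by norm_num)]; linear_combination (τ₁ + 2*τ₂) * hq
  have e2 : η₂ = (2*τ₁ + τ₂) * Real.sqrt 3 / 3 := by
    rw [hη₂, div_eq_div_iff hq0.ne' (by norm_num)]; linear_combination -(2*τ₁ + τ₂) * hq
  clear hη₁ hη₂
  have hDpos : 0 < D := by
    by_contra hn
    have ha : τ₁ = 0 := by nlinarith [sq_nonneg (τ₁ + 2*τ₂), sq_nonneg τ₁]
    have hb : τ₂ = 0 := by nlinarith [sq_nonneg (2*τ₁ + τ₂), sq_nonneg τ₂]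
    rw [hδ, e1, ha, hb] at h
    simp at h
  have n1 : τ₁ ^ 2 + η₁ ^ 2 = 4 / 3 * D := by
    rw [e1, hD]; linear_combination (τ₁ + 2*τ₂)^2 / 9 * hq
  have n2 : τ₂ ^ 2 + η₂ ^ 2 = 4 / 3 * D := by
    rw [e2, hD]; linear_combination (2*τ₁ + τ₂)^2 / 9 * hq
  have n3 : (τ₁ + τ₂) ^ 2 + (η₁ + η₂) ^ 2 = 4 / 3 * D := by
    rw [e1, e2, hD]; linear_combination (τ₁ - τ₂)^2 / 9 * hq
  obtain ⟨q, hqq⟩ : ∃ q, q = Real.sqrt 3 := ⟨_, rfl⟩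
  rw [← hqq] at hq e1 e2 hτ₁ hτ₂
  obtain ⟨i2x, i2y⟩ := steiner_alg x₁ y₁ x₂ y₂ q τ₁ τ₂ hq
  obtain ⟨i4x, i4y⟩ := steiner_alg x₃ y₃ x₄ y₄ q τ₁ τ₂ hq
  obtain ⟨i3x, i3y, isum⟩ := steiner_alg2 x₁ y₁ x₂ y₂ x₃ y₃ x₄ y₄ q τ₁ τ₂ hq hτ₁ hτ₂
  rw [← e1, ← e2, ← hD] at i2x i2y i4x i4y i3x i3y
  rw [← e1, ← e2, ← hD, ← hδ, ← hδ₁, ← hδ₂, ← hδ₃, ← hδ₄] at isum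
  rw [← hδ₁, ← hδ₂] at i2x i2y
  rw [← hδ, ← hδ₁, ← hδ₃] at i3x i3y
  replace i4x : 2 * D * (x₄ - x₃) = q * (δ₃ * τ₁ - δ₄ * τ₂) := by
    rw [hδ₃, hδ₄]; linear_combination i4x
  replace i4y : 2 * D * (y₄ - y₃) = q * (δ₃ * η₁ - δ₄ * η₂) := by
    rw [hδ₃, hδ₄]; linear_combination i4y
  rw [← hqq] at hS₁ hS₂
  have p10 : P₁ 0 = x₁ := by simp [hP₁]
  have p11 : P₁ 1 = y₁ := by simp [hP₁]
  have p20 : P₂ 0 = x₂ := by simp [hP₂]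
  have p21 : P₂ 1 = y₂ := by simp [hP₂]
  have p30 : P₃ 0 = x₃ := by simp [hP₃]
  have p31 : P₃ 1 = y₃ := by simp [hP₃]
  have p40 : P₄ 0 = x₄ := by simp [hP₄]
  have p41 : P₄ 1 = y₄ := by simp [hP₄]
  have s10 : S₁ 0 = x₁ - q / 2 * (δ₁ * τ₁ / D) := by simp [hS₁]
  have s11 : S₁ 1 = y₁ - q / 2 * (δ₁ * η₁ / D) := by simp [hS₁]
  have s20 : S₂ 0 = x₃ + q / 2 * (δ₃ * τ₁ / D) := by simp [hS₂]
  have s21 : S₂ 1 = y₃ + q / 2 * (δ₃ * η₁ / D) := by simp [hS₂]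
  have hD0 := hDpos.ne'
  have hk : q / (2 * D) = Real.sqrt 3 / (2 * D) := by rw [hqq]
  rw [steiner_edge P₁ S₁ _ δ₁ τ₁ η₁ D hDpos h1 hk n1
      (Or.inl (by rw [p10, s10]; field_simp; ring)) (Or.inl (by rw [p11, s11]; field_simp; ring)),
    steiner_edge P₂ S₁ _ δ₂ τ₂ η₂ D hDpos h2 hk n2
      (Or.inl (by rw [p20, s10]; field_simp; linear_combination i2x))
      (Or.inl (by rw [p21, s11]; field_simp; linear_combination i2y)),
    steiner_edge S₁ S₂ _ δ (τ₁ + τ₂) (η₁ + η₂) D hDpos h hk n3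
      (Or.inl (by rw [s10, s20]; field_simp; linear_combination i3x))
      (Or.inl (by rw [s11, s21]; field_simp; linear_combination i3y)),
    steiner_edge P₃ S₂ _ δ₃ τ₁ η₁ D hDpos h3 hk n1
      (Or.inr (by rw [p30, s20]; field_simp; ring)) (Or.inr (by rw [p31, s21]; field_simp; ring)),
    steiner_edge P₄ S₂ _ δ₄ τ₂ η₂ D hDpos h4 hk n2
      (Or.inr (by rw [p40, s20]; field_simp; linear_combination i4x))
      (Or.inr (by rw [p41, s21]; field_simp; linear_combination i4y)),
    ← hD, Real.sqrt_div hDpos.le, ← hqq]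
  have hr : Real.sqrt D ^ 2 = D := Real.sq_sqrt hDpos.le
  have hr0 : 0 < Real.sqrt D := Real.sqrt_pos.mpr hDpos
  have hq1 : 0 < q := by rw [hqq]; exact hq0
  rw [← add_div, ← add_div, ← add_div, ← add_div, div_eq_div_iff hr0.ne' hq1.ne']
  linear_combination isum - hr
end

section
/- If δ > 0, δ₁ > 0, δ₂ > 0, δ₃ > 0, δ₄ > 0, then S₁ ≠ P₁, S₁ ≠ P₂, S₂ ≠ P₃, S₂ ≠ P₄, S₁ ≠ S₂, and the stationarity equations of the objective function |S₁P₁| + |S₁P₂| + |S₁S₂| + |S₂P₃| + |S₂P₄| hold at (S₁, S₂): (S₁ − P₁)/|S₁ − P₁| + (S₁ − P₂)/|S₁ − P₂| + (S₁ − S₂)/|S₁ − S₂| = 0 and (S₂ − P₃)/|S₂ − P₃| + (S₂ − P₄)/|S₂ − P₄| + (S₂ − S₁)/|S₂ − S₁| = 0. -/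
theorem unit_aux {E : Type*} [NormedAddCommGroup E] [NormedSpace ℝ E] (A B u : E) (k : ℝ)
    (hk : 0 < k) (hu : u ≠ 0) (h : A - B = k • u) :
    A ≠ B ∧ (dist A B)⁻¹ • (A - B) = ‖u‖⁻¹ • u := by
  have hne : A ≠ B := by
    intro hAB
    rw [hAB, sub_self] at h
    rcases smul_eq_zero.mp h.symm with h' | h'
    · exact hk.ne' h'
    · exact hu h'
  refine ⟨hne, ?_⟩
  rw [dist_eq_norm, h, norm_smul, Real.norm_of_nonneg hk.le, smul_smul]
  congr 1
  have : ‖u‖ ≠ 0 := norm_ne_zero_iff.mpr hu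
  field_simp

theorem steiner_points_stationarity
    (x₁ y₁ x₂ y₂ x₃ y₃ x₄ y₄ : ℝ)
    (P₁ P₂ P₃ P₄ S₁ S₂ : EuclideanSpace ℝ (Fin 2))
    (hP₁ : P₁ = ![x₁, y₁]) (hP₂ : P₂ = ![x₂, y₂])
    (hP₃ : P₃ = ![x₃, y₃]) (hP₄ : P₄ = ![x₄, y₄])
    (τ₁ τ₂ η₁ η₂ δ δ₁ δ₂ δ₃ δ₄ D : ℝ)
    (hτ₁ : τ₁ = 2*x₁ - x₂ - 2*x₃ + x₄ + Real.sqrt 3 * (y₂ - y₄))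
    (hτ₂ : τ₂ = -x₁ + 2*x₂ + x₃ - 2*x₄ + Real.sqrt 3 * (y₃ - y₁))
    (hη₁ : η₁ = -(τ₁ + 2*τ₂) / Real.sqrt 3)
    (hη₂ : η₂ = (2*τ₁ + τ₂) / Real.sqrt 3)
    (hδ : δ = -(x₁ - x₃) * η₁ + (y₁ - y₃) * τ₁)
    (hδ₁ : δ₁ = (x₁ - x₂) * η₂ - (y₁ - y₂) * τ₂)
    (hδ₂ : δ₂ = (x₁ - x₂) * η₁ - (y₁ - y₂) * τ₁)
    (hδ₃ : δ₃ = -(x₃ - x₄) * η₂ + (y₃ - y₄) * τ₂)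
    (hδ₄ : δ₄ = -(x₃ - x₄) * η₁ + (y₃ - y₄) * τ₁)
    (hD : D = τ₁^2 + τ₁*τ₂ + τ₂^2)
    (hS₁ : S₁ = ![x₁ - Real.sqrt 3 / 2 * (δ₁ * τ₁ / D), y₁ - Real.sqrt 3 / 2 * (δ₁ * η₁ / D)])
    (hS₂ : S₂ = ![x₃ + Real.sqrt 3 / 2 * (δ₃ * τ₁ / D), y₃ + Real.sqrt 3 / 2 * (δ₃ * η₁ / D)])
    (h : 0 < δ) (h1 : 0 < δ₁) (h2 : 0 < δ₂) (h3 : 0 < δ₃) (h4 : 0 < δ₄) :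
    S₁ ≠ P₁ ∧ S₁ ≠ P₂ ∧ S₂ ≠ P₃ ∧ S₂ ≠ P₄ ∧ S₁ ≠ S₂
    ∧ (dist S₁ P₁)⁻¹ • (S₁ - P₁) + (dist S₁ P₂)⁻¹ • (S₁ - P₂)
        + (dist S₁ S₂)⁻¹ • (S₁ - S₂) = 0
    ∧ (dist S₂ P₃)⁻¹ • (S₂ - P₃) + (dist S₂ P₄)⁻¹ • (S₂ - P₄)
        + (dist S₂ S₁)⁻¹ • (S₂ - S₁) = 0 := by
  have hs : Real.sqrt 3 ^ 2 = 3 := Real.sq_sqrt (by norm_num)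
  have hs0 : 0 < Real.sqrt 3 := Real.sqrt_pos.mpr (by norm_num)
  set s := Real.sqrt 3 with hsdef
  have e1 : s * η₁ = -(τ₁ + 2*τ₂) := by rw [hη₁]; field_simp
  have e2 : s * η₂ = 2*τ₁ + τ₂ := by rw [hη₂]; field_simp
  have hD0 : 0 < D := by
    rcases lt_or_ge 0 D with hh | hh
    · exact hh
    · exfalso
      have t1 : τ₁ = 0 := by nlinarith [sq_nonneg (τ₁ + 2*τ₂), sq_nonneg τ₁]
      have t2 : τ₂ = 0 := by nlinarith [sq_nonneg (τ₂ + 2*τ₁), sq_nonneg τ₂]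
      have t3 : η₁ = 0 := by rw [hη₁, t1, t2]; simp
      rw [hδ, t1, t3] at h
      simp at h
  have cr : s * (τ₁ * η₂ - τ₂ * η₁) = 2 * D := by
    linear_combination τ₁ * e2 - τ₂ * e1 - 2 * hD
  have f1 : η₁ = 2 * (y₁ - y₃) - (y₂ - y₄) - s * (x₂ - x₄) := by
    apply mul_left_cancel₀ hs0.ne'
    rw [e1, hτ₁, hτ₂]; linear_combination (x₂ - x₄) * hs
  have f2 : η₂ = s * (x₁ - x₃) + 2 * (y₂ - y₄) - (y₁ - y₃) := by
    apply mul_left_cancel₀ hs0.ne'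
    rw [e2, hτ₁, hτ₂]; linear_combination -(x₁ - x₃) * hs
  have key : δ₁ + δ₃ = (x₁ - x₃) * (η₁ + η₂) - (y₁ - y₃) * (τ₁ + τ₂) := by
    rw [hδ₁, hδ₃, f1, f2, hτ₁, hτ₂]; ring
  have n1 : τ₁^2 + η₁^2 = 4/3 * D := by
    linear_combination (s * η₁ - (τ₁ + 2*τ₂)) / 3 * e1 - η₁^2 / 3 * hs - 4/3 * hD
  have n2 : τ₂^2 + η₂^2 = 4/3 * D := by
    linear_combination (s * η₂ + (2*τ₁ + τ₂)) / 3 * e2 - η₂^2 / 3 * hs - 4/3 * hD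
  have e3 : s * (η₁ + η₂) = τ₁ - τ₂ := by linear_combination e1 + e2
  have n3 : (τ₁ + τ₂)^2 + (η₁ + η₂)^2 = 4/3 * D := by
    linear_combination (s * (η₁ + η₂) + (τ₁ - τ₂)) / 3 * e3 - (η₁ + η₂)^2 / 3 * hs - 4/3 * hD
  obtain ⟨u, hu⟩ : ∃ u : EuclideanSpace ℝ (Fin 2), u = !₂[τ₁, η₁] := ⟨_, rfl⟩
  obtain ⟨v, hv⟩ : ∃ v : EuclideanSpace ℝ (Fin 2), v = !₂[τ₂, η₂] := ⟨_, rfl⟩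
  have nu : ‖u‖ = √(4/3 * D) := by
    rw [hu, EuclideanSpace.norm_eq, ← n1]; simp [Fin.sum_univ_two]
  have nv : ‖v‖ = √(4/3 * D) := by
    rw [hv, EuclideanSpace.norm_eq, ← n2]; simp [Fin.sum_univ_two]
  have nw : ‖u + v‖ = √(4/3 * D) := by
    rw [hu, hv, EuclideanSpace.norm_eq, ← n3]; simp [Fin.sum_univ_two]
  have hm : 0 < √(4/3 * D) := Real.sqrt_pos.mpr (by positivity)
  have u0 : u ≠ 0 := norm_pos_iff.mp (nu ▸ hm)
  have v0 : v ≠ 0 := norm_pos_iff.mp (nv ▸ hm)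
  have w0 : u + v ≠ 0 := norm_pos_iff.mp (nw ▸ hm)
  have a1 : S₁ - P₁ = (s / (2*D) * δ₁) • (-u) := by
    ext i
    fin_cases i <;> simp [hS₁, hP₁, hu] <;> field_simp
  have a3 : S₂ - P₃ = (s / (2*D) * δ₃) • u := by
    ext i
    fin_cases i <;> simp [hS₂, hP₃, hu] <;> field_simp
  have a2 : S₁ - P₂ = (s / (2*D) * δ₂) • (-v) := by
    ext i
    fin_cases i <;> simp [hS₁, hP₂, hv] <;> field_simp <;> rw [hδ₁, hδ₂]
    · linear_combination -(x₁ - x₂) * cr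
    · linear_combination -(y₁ - y₂) * cr
  have a4 : S₂ - P₄ = (s / (2*D) * δ₄) • v := by
    ext i
    fin_cases i <;> simp [hS₂, hP₄, hv] <;> field_simp <;> rw [hδ₃, hδ₄]
    · linear_combination -(x₃ - x₄) * cr
    · linear_combination -(y₃ - y₄) * cr
  have a5 : S₁ - S₂ = (s / (2*D) * δ) • (u + v) := by
    ext i
    fin_cases i <;> simp [hS₁, hS₂, hu, hv] <;> field_simp <;> rw [hδ]
    · linear_combination -(x₁ - x₃) * cr - s * τ₁ * key
    · linear_combination -(y₁ - y₃) * cr - s * η₁ * key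
  have a6 : S₂ - S₁ = (s / (2*D) * δ) • (-(u + v)) := by
    rw [smul_neg, ← a5, neg_sub]
  obtain ⟨b1, c1⟩ := unit_aux _ _ _ _ (by positivity) (neg_ne_zero.mpr u0) a1
  obtain ⟨b2, c2⟩ := unit_aux _ _ _ _ (by positivity) (neg_ne_zero.mpr v0) a2
  obtain ⟨b3, c3⟩ := unit_aux _ _ _ _ (by positivity) u0 a3
  obtain ⟨b4, c4⟩ := unit_aux _ _ _ _ (by positivity) v0 a4
  obtain ⟨b5, c5⟩ := unit_aux _ _ _ _ (by positivity) w0 a5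
  obtain ⟨b6, c6⟩ := unit_aux _ _ _ _ (by positivity) (neg_ne_zero.mpr w0) a6
  refine ⟨b1, b2, b3, b4, b5, ?_, ?_⟩
  · rw [c1, c2, c5, norm_neg, norm_neg, nu, nv, nw, ← smul_add, ← smul_add]
    module
  · rw [c3, c4, c6, norm_neg, nu, nv, nw, ← smul_add, ← smul_add]
    simp
end

section
/- If D ≠ 0, then writing S₁ = (x₊, y₊), the following four signed-area identities hold: det[[1,1,1],[x₁,x₂,x₊],[y₁,y₂,y₊]] = (√3/2)·δ₁δ₂/D, det[[1,1,1],[x₂,x₃,x₊],[y₂,y₃,y₊]] = (√3/2)·(δδ₂ + δ₂δ₃)/D, det[[1,1,1],[x₃,x₄,x₊],[y₃,y₄,y₊]] = (√3/2)·(δ₃δ₄ + δ₃δ + δ₄δ)/D, and det[[1,1,1],[x₄,x₁,x₊],[y₄,y₁,y₊]] = (√3/2)·(δδ₁ + δ₁δ₄)/D. In particular, if δ, δ₁, δ₂, δ₃, δ₄ are all positive, then S₁ lies strictly inside the quadrilateral P₁P₂P₃P₄. -/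
theorem steiner_point_inside_quadrilateral
    (x₁ y₁ x₂ y₂ x₃ y₃ x₄ y₄ : ℝ)
    (P₁ P₂ P₃ P₄ S₁ S₂ : EuclideanSpace ℝ (Fin 2))
    (hP₁ : P₁ = ![x₁, y₁]) (hP₂ : P₂ = ![x₂, y₂])
    (hP₃ : P₃ = ![x₃, y₃]) (hP₄ : P₄ = ![x₄, y₄])
    (τ₁ τ₂ η₁ η₂ δ δ₁ δ₂ δ₃ δ₄ D : ℝ)
    (hτ₁ : τ₁ = 2*x₁ - x₂ - 2*x₃ + x₄ + Real.sqrt 3 * (y₂ - y₄))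
    (hτ₂ : τ₂ = -x₁ + 2*x₂ + x₃ - 2*x₄ + Real.sqrt 3 * (y₃ - y₁))
    (hη₁ : η₁ = -(τ₁ + 2*τ₂) / Real.sqrt 3)
    (hη₂ : η₂ = (2*τ₁ + τ₂) / Real.sqrt 3)
    (hδ : δ = -(x₁ - x₃) * η₁ + (y₁ - y₃) * τ₁)
    (hδ₁ : δ₁ = (x₁ - x₂) * η₂ - (y₁ - y₂) * τ₂)
    (hδ₂ : δ₂ = (x₁ - x₂) * η₁ - (y₁ - y₂) * τ₁)
    (hδ₃ : δ₃ = -(x₃ - x₄) * η₂ + (y₃ - y₄) * τ₂)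
    (hδ₄ : δ₄ = -(x₃ - x₄) * η₁ + (y₃ - y₄) * τ₁)
    (hD : D = τ₁^2 + τ₁*τ₂ + τ₂^2)
    (hS₁ : S₁ = ![x₁ - Real.sqrt 3 / 2 * (δ₁ * τ₁ / D), y₁ - Real.sqrt 3 / 2 * (δ₁ * η₁ / D)])
    (hS₂ : S₂ = ![x₃ + Real.sqrt 3 / 2 * (δ₃ * τ₁ / D), y₃ + Real.sqrt 3 / 2 * (δ₃ * η₁ / D)])
    (hD0 : D ≠ 0) :
    (Matrix.det !![1, 1, 1; x₁, x₂, x₁ - Real.sqrt 3 / 2 * (δ₁ * τ₁ / D);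
                   y₁, y₂, y₁ - Real.sqrt 3 / 2 * (δ₁ * η₁ / D)]
        = Real.sqrt 3 / 2 * (δ₁ * δ₂ / D))
    ∧ (Matrix.det !![1, 1, 1; x₂, x₃, x₁ - Real.sqrt 3 / 2 * (δ₁ * τ₁ / D);
                     y₂, y₃, y₁ - Real.sqrt 3 / 2 * (δ₁ * η₁ / D)]
        = Real.sqrt 3 / 2 * ((δ * δ₂ + δ₂ * δ₃) / D))
    ∧ (Matrix.det !![1, 1, 1; x₃, x₄, x₁ - Real.sqrt 3 / 2 * (δ₁ * τ₁ / D);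
                     y₃, y₄, y₁ - Real.sqrt 3 / 2 * (δ₁ * η₁ / D)]
        = Real.sqrt 3 / 2 * ((δ₃ * δ₄ + δ₃ * δ + δ₄ * δ) / D))
    ∧ (Matrix.det !![1, 1, 1; x₄, x₁, x₁ - Real.sqrt 3 / 2 * (δ₁ * τ₁ / D);
                     y₄, y₁, y₁ - Real.sqrt 3 / 2 * (δ₁ * η₁ / D)]
        = Real.sqrt 3 / 2 * ((δ * δ₁ + δ₁ * δ₄) / D))
    ∧ (0 < δ → 0 < δ₁ → 0 < δ₂ → 0 < δ₃ → 0 < δ₄ →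
        0 < Matrix.det !![1, 1, 1; x₁, x₂, x₁ - Real.sqrt 3 / 2 * (δ₁ * τ₁ / D);
                          y₁, y₂, y₁ - Real.sqrt 3 / 2 * (δ₁ * η₁ / D)]
        ∧ 0 < Matrix.det !![1, 1, 1; x₂, x₃, x₁ - Real.sqrt 3 / 2 * (δ₁ * τ₁ / D);
                            y₂, y₃, y₁ - Real.sqrt 3 / 2 * (δ₁ * η₁ / D)]
        ∧ 0 < Matrix.det !![1, 1, 1; x₃, x₄, x₁ - Real.sqrt 3 / 2 * (δ₁ * τ₁ / D);
                            y₃, y₄, y₁ - Real.sqrt 3 / 2 * (δ₁ * η₁ / D)]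
        ∧ 0 < Matrix.det !![1, 1, 1; x₄, x₁, x₁ - Real.sqrt 3 / 2 * (δ₁ * τ₁ / D);
                            y₄, y₁, y₁ - Real.sqrt 3 / 2 * (δ₁ * η₁ / D)]) := by
  have hs0 : Real.sqrt 3 > 0 := by positivity
  have hs : Real.sqrt 3 ^ 2 = 3 := Real.sq_sqrt (by norm_num)
  clear hS₁ hS₂ hP₁ hP₂ hP₃ hP₄
  generalize Real.sqrt 3 = s at *
  have hinv : s⁻¹ = s / 3 := by field_simp; linarith
  rw [div_eq_mul_inv, hinv] at hη₁ hη₂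
  have hDpos : 0 < D := by
    have : 0 ≤ D := by rw [hD]; nlinarith [sq_nonneg (τ₁ + τ₂), sq_nonneg τ₁, sq_nonneg τ₂]
    exact lt_of_le_of_ne this (Ne.symm hD0)
  have h1 : Matrix.det !![1, 1, 1; x₁, x₂, x₁ - s / 2 * (δ₁ * τ₁ / D);
                   y₁, y₂, y₁ - s / 2 * (δ₁ * η₁ / D)] = s / 2 * (δ₁ * δ₂ / D) := by
    simp only [Matrix.det_fin_three, Matrix.of_apply, Matrix.cons_val]
    rw [hδ₂]; ring
  have h4 : Matrix.det !![1, 1, 1; x₄, x₁, x₁ - s / 2 * (δ₁ * τ₁ / D);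
                     y₄, y₁, y₁ - s / 2 * (δ₁ * η₁ / D)]
        = s / 2 * ((δ * δ₁ + δ₁ * δ₄) / D) := by
    simp only [Matrix.det_fin_three, Matrix.of_apply, Matrix.cons_val]
    rw [hδ₄, hδ]; ring
  have hc : s * (τ₁ * η₂ - τ₂ * η₁) = 2 * D := by
    rw [hη₁, hη₂, hD]
    linear_combination 2 / 3 * (τ₁ ^ 2 + τ₁ * τ₂ + τ₂ ^ 2) * hs
  have hε : (x₁ - x₃) * η₂ - (y₁ - y₃) * τ₂ = δ + δ₁ + δ₃ := by
    subst hδ hδ₁ hδ₃ hη₁ hη₂ hτ₁ hτ₂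
    clear hc hD0 hDpos hinv h1 h4
    grind
  have h2 : Matrix.det !![1, 1, 1; x₂, x₃, x₁ - s / 2 * (δ₁ * τ₁ / D);
                     y₂, y₃, y₁ - s / 2 * (δ₁ * η₁ / D)]
        = s / 2 * ((δ * δ₂ + δ₂ * δ₃) / D) := by
    simp only [Matrix.det_fin_three, Matrix.of_apply, Matrix.cons_val]
    have hA : (x₃ - x₂) * (y₁ - y₂) - (y₃ - y₂) * (x₁ - x₂)
        = s / 2 * ((δ₁ * δ₂ + δ₁ * δ + δ * δ₂ + δ₂ * δ₃) / D) := by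
      have h : D * 2 * ((x₃ - x₂) * (y₁ - y₂) - (y₃ - y₂) * (x₁ - x₂))
          = s * (δ₁ * δ₂ + δ₁ * δ + δ * δ₂ + δ₂ * δ₃) := by
        have e : δ₁ * δ₂ + δ₁ * δ + δ * δ₂ + δ₂ * δ₃ = δ₂ * (δ + δ₁ + δ₃) + δ₁ * δ := by ring
        rw [e, ← hε, mul_comm D 2, ← hc, hδ₂, hδ₁, hδ]
        ring
      field_simp
      linear_combination h
    have hB : (x₃ - x₂) * η₁ - (y₃ - y₂) * τ₁ = δ₂ + δ := by rw [hδ₂, hδ]; ring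
    linear_combination hA - s / 2 * (δ₁ / D) * hB
  have h3 : Matrix.det !![1, 1, 1; x₃, x₄, x₁ - s / 2 * (δ₁ * τ₁ / D);
                     y₃, y₄, y₁ - s / 2 * (δ₁ * η₁ / D)]
        = s / 2 * ((δ₃ * δ₄ + δ₃ * δ + δ₄ * δ) / D) := by
    simp only [Matrix.det_fin_three, Matrix.of_apply, Matrix.cons_val]
    have hA : (x₄ - x₃) * (y₁ - y₃) - (y₄ - y₃) * (x₁ - x₃)
        = s / 2 * ((δ₃ * δ₄ + δ₃ * δ + δ₄ * δ + δ₁ * δ₄) / D) := by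
      have h : D * 2 * ((x₄ - x₃) * (y₁ - y₃) - (y₄ - y₃) * (x₁ - x₃))
          = s * (δ₃ * δ₄ + δ₃ * δ + δ₄ * δ + δ₁ * δ₄) := by
        have e : δ₃ * δ₄ + δ₃ * δ + δ₄ * δ + δ₁ * δ₄ = δ₄ * (δ + δ₁ + δ₃) + δ₃ * δ := by ring
        rw [e, ← hε, mul_comm D 2, ← hc, hδ₄, hδ₃, hδ]
        ring
      field_simp
      linear_combination h
    linear_combination hA + s / 2 * (δ₁ / D) * hδ₄
  refine ⟨h1, h2, h3, h4, fun _ _ _ _ _ => ?_⟩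
  rw [h1, h2, h3, h4]
  refine ⟨?_, ?_, ?_, ?_⟩ <;> positivity
end

section
/- One has |Q₁ − Q₂|² = D/3 = (τ₁² + τ₁τ₂ + τ₂²)/3; that is, the distance between the apexes Q₁ and Q₂ of the outward equilateral triangles built on P₁P₂ and P₃P₄ equals the length √(D/3) of the Steiner tree of topology P₁,P₂—S₁—S₂—P₃,P₄. -/
theorem apex_distance_equals_tree_length
    (x₁ y₁ x₂ y₂ x₃ y₃ x₄ y₄ : ℝ)
    (P₁ P₂ P₃ P₄ S₁ S₂ : EuclideanSpace ℝ (Fin 2))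
    (hP₁ : P₁ = ![x₁, y₁]) (hP₂ : P₂ = ![x₂, y₂])
    (hP₃ : P₃ = ![x₃, y₃]) (hP₄ : P₄ = ![x₄, y₄])
    (τ₁ τ₂ η₁ η₂ δ δ₁ δ₂ δ₃ δ₄ D : ℝ)
    (hτ₁ : τ₁ = 2*x₁ - x₂ - 2*x₃ + x₄ + Real.sqrt 3 * (y₂ - y₄))
    (hτ₂ : τ₂ = -x₁ + 2*x₂ + x₃ - 2*x₄ + Real.sqrt 3 * (y₃ - y₁))
    (hη₁ : η₁ = -(τ₁ + 2*τ₂) / Real.sqrt 3)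
    (hη₂ : η₂ = (2*τ₁ + τ₂) / Real.sqrt 3)
    (hδ : δ = -(x₁ - x₃) * η₁ + (y₁ - y₃) * τ₁)
    (hδ₁ : δ₁ = (x₁ - x₂) * η₂ - (y₁ - y₂) * τ₂)
    (hδ₂ : δ₂ = (x₁ - x₂) * η₁ - (y₁ - y₂) * τ₁)
    (hδ₃ : δ₃ = -(x₃ - x₄) * η₂ + (y₃ - y₄) * τ₂)
    (hδ₄ : δ₄ = -(x₃ - x₄) * η₁ + (y₃ - y₄) * τ₁)
    (hD : D = τ₁^2 + τ₁*τ₂ + τ₂^2)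
    (hS₁ : S₁ = ![x₁ - Real.sqrt 3 / 2 * (δ₁ * τ₁ / D), y₁ - Real.sqrt 3 / 2 * (δ₁ * η₁ / D)])
    (hS₂ : S₂ = ![x₃ + Real.sqrt 3 / 2 * (δ₃ * τ₁ / D), y₃ + Real.sqrt 3 / 2 * (δ₃ * η₁ / D)])
    (Q₁ Q₂ : EuclideanSpace ℝ (Fin 2))
    (hQ₁ : Q₁ = ![(1/2)*x₁ + (1/2)*x₂ - Real.sqrt 3 / 2 * y₁ + Real.sqrt 3 / 2 * y₂,
                  Real.sqrt 3 / 2 * x₁ - Real.sqrt 3 / 2 * x₂ + (1/2)*y₁ + (1/2)*y₂])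
    (hQ₂ : Q₂ = ![(1/2)*x₃ + (1/2)*x₄ - Real.sqrt 3 / 2 * y₃ + Real.sqrt 3 / 2 * y₄,
                  Real.sqrt 3 / 2 * x₃ - Real.sqrt 3 / 2 * x₄ + (1/2)*y₃ + (1/2)*y₄]) :
    dist Q₁ Q₂ ^ 2 = D / 3 ∧ D / 3 = (τ₁^2 + τ₁*τ₂ + τ₂^2) / 3 := by
  have h3 : Real.sqrt 3 ^ 2 = 3 := Real.sq_sqrt (by norm_num)
  refine ⟨?_, by rw [hD]⟩
  rw [EuclideanSpace.dist_eq, Real.sq_sqrt (by positivity)]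
  simp only [Fin.sum_univ_two, Real.dist_eq, sq_abs, hQ₁, hQ₂, Matrix.cons_val_zero,
    Matrix.cons_val_one]
  rw [hD, hτ₁, hτ₂]
  generalize Real.sqrt 3 = s at h3
  ring_nf
  simp only [h3]
  ring
end

section
/- Assume P₁ ≠ P₃, P₂ ≠ P₄, and (x₁ − x₃)(y₂ − y₄) − (y₁ − y₃)(x₂ − x₄) ≥ 0. Let ψ ∈ [0, π] be the angle between the diagonal vectors P₃ − P₁ and P₄ − P₂. Then D/3 = r₁₃² + r₂₄² − 2·r₁₃·r₂₄·cos(ψ + π/3); that is, the length of the Steiner tree of topology P₁,P₂—S₁—S₂—P₃,P₄ equals the third side of a triangle whose other two sides are the diagonals r₁₃ and r₂₄ with included angle ψ + π/3. -/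
theorem tree_length_law_of_cosines
    (x₁ y₁ x₂ y₂ x₃ y₃ x₄ y₄ : ℝ)
    (P₁ P₂ P₃ P₄ S₁ S₂ : EuclideanSpace ℝ (Fin 2))
    (hP₁ : P₁ = ![x₁, y₁]) (hP₂ : P₂ = ![x₂, y₂])
    (hP₃ : P₃ = ![x₃, y₃]) (hP₄ : P₄ = ![x₄, y₄])
    (τ₁ τ₂ η₁ η₂ δ δ₁ δ₂ δ₃ δ₄ D : ℝ)
    (hτ₁ : τ₁ = 2*x₁ - x₂ - 2*x₃ + x₄ + Real.sqrt 3 * (y₂ - y₄))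
    (hτ₂ : τ₂ = -x₁ + 2*x₂ + x₃ - 2*x₄ + Real.sqrt 3 * (y₃ - y₁))
    (hη₁ : η₁ = -(τ₁ + 2*τ₂) / Real.sqrt 3)
    (hη₂ : η₂ = (2*τ₁ + τ₂) / Real.sqrt 3)
    (hδ : δ = -(x₁ - x₃) * η₁ + (y₁ - y₃) * τ₁)
    (hδ₁ : δ₁ = (x₁ - x₂) * η₂ - (y₁ - y₂) * τ₂)
    (hδ₂ : δ₂ = (x₁ - x₂) * η₁ - (y₁ - y₂) * τ₁)
    (hδ₃ : δ₃ = -(x₃ - x₄) * η₂ + (y₃ - y₄) * τ₂)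
    (hδ₄ : δ₄ = -(x₃ - x₄) * η₁ + (y₃ - y₄) * τ₁)
    (hD : D = τ₁^2 + τ₁*τ₂ + τ₂^2)
    (hS₁ : S₁ = ![x₁ - Real.sqrt 3 / 2 * (δ₁ * τ₁ / D), y₁ - Real.sqrt 3 / 2 * (δ₁ * η₁ / D)])
    (hS₂ : S₂ = ![x₃ + Real.sqrt 3 / 2 * (δ₃ * τ₁ / D), y₃ + Real.sqrt 3 / 2 * (δ₃ * η₁ / D)])
    (r₁₃ r₂₄ : ℝ) (hr₁₃ : r₁₃ = dist P₁ P₃) (hr₂₄ : r₂₄ = dist P₂ P₄)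
    (h13 : P₁ ≠ P₃) (h24 : P₂ ≠ P₄)
    (hcross : (x₁ - x₃)*(y₂ - y₄) - (y₁ - y₃)*(x₂ - x₄) ≥ 0)
    (ψ : ℝ) (hψ : ψ = InnerProductGeometry.angle (P₃ - P₁) (P₄ - P₂)) :
    D / 3 = r₁₃^2 + r₂₄^2 - 2 * r₁₃ * r₂₄ * Real.cos (ψ + Real.pi / 3) := by
  have h3 : Real.sqrt 3 * Real.sqrt 3 = 3 := Real.mul_self_sqrt (by norm_num)
  have a0 : ∀ i, P₁ i = ![x₁, y₁] i := fun i => by rw [hP₁]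
  have b0 : ∀ i, P₂ i = ![x₂, y₂] i := fun i => by rw [hP₂]
  have c0 : ∀ i, P₃ i = ![x₃, y₃] i := fun i => by rw [hP₃]
  have d0 : ∀ i, P₄ i = ![x₄, y₄] i := fun i => by rw [hP₄]
  have n1 : r₁₃ = ‖P₃ - P₁‖ := by rw [hr₁₃, dist_comm, dist_eq_norm]
  have n2 : r₂₄ = ‖P₄ - P₂‖ := by rw [hr₂₄, dist_comm, dist_eq_norm]
  have q1 : r₁₃ ^ 2 = (x₃ - x₁) ^ 2 + (y₃ - y₁) ^ 2 := by
    rw [n1, EuclideanSpace.norm_sq_eq]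
    simp [a0, c0]
  have q2 : r₂₄ ^ 2 = (x₄ - x₂) ^ 2 + (y₄ - y₂) ^ 2 := by
    rw [n2, EuclideanSpace.norm_sq_eq]
    simp [b0, d0]
  have hin : inner ℝ (P₃ - P₁) (P₄ - P₂) = (x₃ - x₁) * (x₄ - x₂) + (y₃ - y₁) * (y₄ - y₂) := by
    simp [PiLp.inner_apply, a0, b0, c0, d0]
    ring
  have hcos : Real.cos ψ * (r₁₃ * r₂₄) = (x₃ - x₁) * (x₄ - x₂) + (y₃ - y₁) * (y₄ - y₂) := by
    rw [hψ, n1, n2, InnerProductGeometry.cos_angle_mul_norm_mul_norm, hin]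
  have hs0 : 0 ≤ Real.sin ψ := by
    rw [hψ]; exact InnerProductGeometry.sin_angle_nonneg _ _
  have hr1 : 0 ≤ r₁₃ := by rw [n1]; positivity
  have hr2 : 0 ≤ r₂₄ := by rw [n2]; positivity
  have hsin : Real.sin ψ * (r₁₃ * r₂₄) = (x₁ - x₃)*(y₂ - y₄) - (y₁ - y₃)*(x₂ - x₄) := by
    refine (sq_eq_sq₀ (by positivity) hcross).1 ?_
    have e : (Real.sin ψ * (r₁₃ * r₂₄)) ^ 2
        = r₁₃ ^ 2 * r₂₄ ^ 2 - (Real.cos ψ * (r₁₃ * r₂₄)) ^ 2 := by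
      rw [mul_pow, Real.sin_sq]; ring
    rw [e, hcos, q1, q2]; ring
  rw [Real.cos_add, Real.cos_pi_div_three, Real.sin_pi_div_three, hD, hτ₁, hτ₂]
  linear_combination -q1 - q2 + hcos - Real.sqrt 3 * hsin
    + ((y₂ - y₄) ^ 2 + (y₂ - y₄) * (y₃ - y₁) + (y₃ - y₁) ^ 2) / 3 * h3
end

section
/- If δ > 0, δ₁ > 0, δ₂ > 0, δ₃ > 0, δ₄ > 0, then the Steiner point S₁ lies on the circle centered at C = ((1/2)x₁ + (1/2)x₂ − y₁/(2√3) + y₂/(2√3), x₁/(2√3) − x₂/(2√3) + (1/2)y₁ + (1/2)y₂) of radius r₁₂/√3, i.e. |S₁ − C| = r₁₂/√3. -/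
theorem steiner_point_S1_on_circle
    (x₁ y₁ x₂ y₂ x₃ y₃ x₄ y₄ : ℝ)
    (P₁ P₂ P₃ P₄ S₁ S₂ : EuclideanSpace ℝ (Fin 2))
    (hP₁ : P₁ = ![x₁, y₁]) (hP₂ : P₂ = ![x₂, y₂])
    (hP₃ : P₃ = ![x₃, y₃]) (hP₄ : P₄ = ![x₄, y₄])
    (τ₁ τ₂ η₁ η₂ δ δ₁ δ₂ δ₃ δ₄ D : ℝ)
    (hτ₁ : τ₁ = 2*x₁ - x₂ - 2*x₃ + x₄ + Real.sqrt 3 * (y₂ - y₄))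
    (hτ₂ : τ₂ = -x₁ + 2*x₂ + x₃ - 2*x₄ + Real.sqrt 3 * (y₃ - y₁))
    (hη₁ : η₁ = -(τ₁ + 2*τ₂) / Real.sqrt 3)
    (hη₂ : η₂ = (2*τ₁ + τ₂) / Real.sqrt 3)
    (hδ : δ = -(x₁ - x₃) * η₁ + (y₁ - y₃) * τ₁)
    (hδ₁ : δ₁ = (x₁ - x₂) * η₂ - (y₁ - y₂) * τ₂)
    (hδ₂ : δ₂ = (x₁ - x₂) * η₁ - (y₁ - y₂) * τ₁)
    (hδ₃ : δ₃ = -(x₃ - x₄) * η₂ + (y₃ - y₄) * τ₂)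
    (hδ₄ : δ₄ = -(x₃ - x₄) * η₁ + (y₃ - y₄) * τ₁)
    (hD : D = τ₁^2 + τ₁*τ₂ + τ₂^2)
    (hS₁ : S₁ = ![x₁ - Real.sqrt 3 / 2 * (δ₁ * τ₁ / D), y₁ - Real.sqrt 3 / 2 * (δ₁ * η₁ / D)])
    (hS₂ : S₂ = ![x₃ + Real.sqrt 3 / 2 * (δ₃ * τ₁ / D), y₃ + Real.sqrt 3 / 2 * (δ₃ * η₁ / D)])
    (r₁₂ : ℝ) (hr₁₂ : r₁₂ = dist P₁ P₂)
    (C : EuclideanSpace ℝ (Fin 2))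
    (hC : C = ![(1/2)*x₁ + (1/2)*x₂ - y₁/(2*Real.sqrt 3) + y₂/(2*Real.sqrt 3),
                x₁/(2*Real.sqrt 3) - x₂/(2*Real.sqrt 3) + (1/2)*y₁ + (1/2)*y₂])
    (h : 0 < δ) (h1 : 0 < δ₁) (h2 : 0 < δ₂) (h3 : 0 < δ₃) (h4 : 0 < δ₄) :
    dist S₁ C = r₁₂ / Real.sqrt 3 := by
  have hs : Real.sqrt 3 ^ 2 = 3 := Real.sq_sqrt (by norm_num)
  have hs0 : 0 < Real.sqrt 3 := Real.sqrt_pos.mpr (by norm_num)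
  have e10 : P₁ 0 = x₁ := by simpa using congrFun hP₁ 0
  have e11 : P₁ 1 = y₁ := by simpa using congrFun hP₁ 1
  have e20 : P₂ 0 = x₂ := by simpa using congrFun hP₂ 0
  have e21 : P₂ 1 = y₂ := by simpa using congrFun hP₂ 1
  have eS0 := congrFun hS₁ 0
  have eS1 := congrFun hS₁ 1
  have eC0 := congrFun hC 0
  have eC1 := congrFun hC 1
  simp only [Matrix.cons_val_zero, Matrix.cons_val_one] at eS0 eS1 eC0 eC1
  clear hP₁ hP₂ hP₃ hP₄ hS₁ hS₂ hC hδ hδ₂ hδ₃ hδ₄ hτ₁ hτ₂ h h2 h3 h4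
  rw [hr₁₂, EuclideanSpace.dist_eq, EuclideanSpace.dist_eq, ← Real.sqrt_div' _ (by norm_num)]
  congr 1
  simp only [Fin.sum_univ_two, Real.dist_eq, sq_abs]
  rw [e10, e11, e20, e21, eS0, eS1, eC0, eC1]
  have i1 : ∀ a : ℝ, a / Real.sqrt 3 = a * Real.sqrt 3 / 3 := by
    intro a; field_simp; rw [hs]; try ring
  have i2 : ∀ a : ℝ, a / (2 * Real.sqrt 3) = a * Real.sqrt 3 / 6 := by
    intro a; field_simp; rw [hs]; try ring
  rw [i1] at hη₁ hη₂
  simp only [i2]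
  generalize Real.sqrt 3 = s at *
  have hD0 : D ≠ 0 := by
    intro h0
    have ha : τ₁ = 0 := by nlinarith [sq_nonneg (τ₁ + 2 * τ₂), sq_nonneg τ₁]
    have hb : τ₂ = 0 := by subst ha; nlinarith [sq_nonneg τ₂]
    subst ha hb
    simp [hη₂] at hδ₁
    linarith
  have k1 : τ₁ ^ 2 + η₁ ^ 2 = 4 / 3 * D := by
    rw [hη₁, hD]; linear_combination (τ₁ + 2 * τ₂) ^ 2 / 9 * hs
  have k2 : δ₁ = s * (((x₁ - x₂) / 2 + (y₁ - y₂) * s / 6) * τ₁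
      + ((y₁ - y₂) / 2 - (x₁ - x₂) * s / 6) * η₁) := by
    rw [hδ₁, hη₁, hη₂]; grind
  obtain ⟨q, hq⟩ : ∃ q, q = δ₁ / D := ⟨_, rfl⟩
  have hqD : q * D = δ₁ := by rw [hq]; field_simp
  have j : ∀ a : ℝ, δ₁ * a / D = q * a := by intro a; rw [hq]; ring
  simp only [j]
  linear_combination (s ^ 2 * q ^ 2 / 4) * k1 + q * k2 + (q * hqD) + (q ^ 2 * D / 3 + ((x₁ - x₂) ^ 2 + (y₁ - y₂) ^ 2) / 36) * hs
end

section
/- If δ > 0, δ₁ > 0, δ₂ > 0, δ₃ > 0, δ₄ > 0, and 𝔖₁₂₄ > 0 (the points P₁, P₂, P₄ are numbered counterclockwise), then the Steiner point S₂ lies on the circle centered at Ĉ of radius r̂, i.e. |S₂ − Ĉ| = r̂. -/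
/-- The rational identity behind the theorem, after the rescaling `y = √3 Y`. -/
theorem steiner_key (x₁ Y₁ x₂ Y₂ x₃ Y₃ x₄ Y₄ t u d D : ℝ)
    (ht : t = 2*x₁ - x₂ - 2*x₃ + x₄ + 3 * (Y₂ - Y₄))
    (hu : u = -x₁ + 2*x₂ + x₃ - 2*x₄ + 3 * (Y₃ - Y₁))
    (hd : d = -(x₃ - x₄) * ((2*t+u)/3) + (Y₃ - Y₄) * u)
    (hD : D = t^2 + t*u + u^2) (hD0 : D ≠ 0) :
    (x₃ + 3/2 * (d * t / D) - ((1/2)*x₁ + (1/2)*x₄ + (-Y₁ + 2*Y₂ - Y₄)/2))^2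
    + 3 * (Y₃ + 3/2 * (d * (-(t+2*u)/3) / D) - ((1/2)*Y₁ + (1/2)*Y₄ + (x₁ - 2*x₂ + x₄)/6))^2
    = (1/3) * ((((x₁-x₂)^2 + 3*(Y₁-Y₂)^2) + ((x₁-x₄)^2 + 3*(Y₁-Y₄)^2)
      + ((x₂-x₄)^2 + 3*(Y₂-Y₄)^2))/2
      + 3 * ((x₂ - x₁)*(Y₄ - Y₁) - (x₄ - x₁)*(Y₂ - Y₁))) := by
  obtain ⟨k, hk⟩ : ∃ k, k = d / D := ⟨_, rfl⟩
  have hkD : k * D = d := by rw [hk]; field_simp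
  have e1 : d * t / D = k * t := by rw [hk]; ring
  have e2 : d * (-(t+2*u)/3) / D = k * (-(t+2*u)/3) := by rw [hk]; ring
  rw [e1, e2]
  have key : D * ((x₃ - ((1/2)*x₁ + (1/2)*x₄ + (-Y₁ + 2*Y₂ - Y₄)/2))^2
    + 3 * (Y₃ - ((1/2)*Y₁ + (1/2)*Y₄ + (x₁ - 2*x₂ + x₄)/6))^2
    - (1/3) * ((((x₁-x₂)^2 + 3*(Y₁-Y₂)^2) + ((x₁-x₄)^2 + 3*(Y₁-Y₄)^2)
      + ((x₂-x₄)^2 + 3*(Y₂-Y₄)^2))/2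
      + 3 * ((x₂ - x₁)*(Y₄ - Y₁) - (x₄ - x₁)*(Y₂ - Y₁))))
    + 3 * d * ((x₃ - ((1/2)*x₁ + (1/2)*x₄ + (-Y₁ + 2*Y₂ - Y₄)/2)) * t
      - (Y₃ - ((1/2)*Y₁ + (1/2)*Y₄ + (x₁ - 2*x₂ + x₄)/6)) * (t+2*u)) + 3 * d^2 = 0 := by
    subst hD hd ht hu
    ring
  apply mul_left_cancel₀ hD0
  rw [← hkD] at key
  have h0 : t^2 + t*u + u^2 - D = 0 := by rw [hD]; ring
  linear_combination key + 3 * D * k^2 * h0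


theorem steiner_zero (t u : ℝ) (h : t^2 + t*u + u^2 = 0) : t = 0 ∧ u = 0 := by
  have a : t^2 = 0 := by
    apply le_antisymm _ (sq_nonneg t)
    linarith [sq_nonneg (t + 2*u), sq_nonneg t]
  have b : u^2 = 0 := by
    apply le_antisymm _ (sq_nonneg u)
    linarith [sq_nonneg (2*t + u), sq_nonneg u]
  exact ⟨by simpa using a, by simpa using b⟩

theorem steiner_point_S2_on_circle
    (x₁ y₁ x₂ y₂ x₃ y₃ x₄ y₄ : ℝ)
    (P₁ P₂ P₃ P₄ S₁ S₂ : EuclideanSpace ℝ (Fin 2))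
    (hP₁ : P₁ = ![x₁, y₁]) (hP₂ : P₂ = ![x₂, y₂])
    (hP₃ : P₃ = ![x₃, y₃]) (hP₄ : P₄ = ![x₄, y₄])
    (τ₁ τ₂ η₁ η₂ δ δ₁ δ₂ δ₃ δ₄ D : ℝ)
    (hτ₁ : τ₁ = 2*x₁ - x₂ - 2*x₃ + x₄ + Real.sqrt 3 * (y₂ - y₄))
    (hτ₂ : τ₂ = -x₁ + 2*x₂ + x₃ - 2*x₄ + Real.sqrt 3 * (y₃ - y₁))
    (hη₁ : η₁ = -(τ₁ + 2*τ₂) / Real.sqrt 3)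
    (hη₂ : η₂ = (2*τ₁ + τ₂) / Real.sqrt 3)
    (hδ : δ = -(x₁ - x₃) * η₁ + (y₁ - y₃) * τ₁)
    (hδ₁ : δ₁ = (x₁ - x₂) * η₂ - (y₁ - y₂) * τ₂)
    (hδ₂ : δ₂ = (x₁ - x₂) * η₁ - (y₁ - y₂) * τ₁)
    (hδ₃ : δ₃ = -(x₃ - x₄) * η₂ + (y₃ - y₄) * τ₂)
    (hδ₄ : δ₄ = -(x₃ - x₄) * η₁ + (y₃ - y₄) * τ₁)
    (hD : D = τ₁^2 + τ₁*τ₂ + τ₂^2)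
    (hS₁ : S₁ = ![x₁ - Real.sqrt 3 / 2 * (δ₁ * τ₁ / D), y₁ - Real.sqrt 3 / 2 * (δ₁ * η₁ / D)])
    (hS₂ : S₂ = ![x₃ + Real.sqrt 3 / 2 * (δ₃ * τ₁ / D), y₃ + Real.sqrt 3 / 2 * (δ₃ * η₁ / D)])
    (r₁₂ r₁₄ r₂₄ : ℝ)
    (hr₁₂ : r₁₂ = dist P₁ P₂) (hr₁₄ : r₁₄ = dist P₁ P₄) (hr₂₄ : r₂₄ = dist P₂ P₄)
    (𝔖₁₂₄ : ℝ) (h𝔖 : 𝔖₁₂₄ = (x₂ - x₁)*(y₄ - y₁) - (x₄ - x₁)*(y₂ - y₁))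
    (Chat : EuclideanSpace ℝ (Fin 2))
    (hChat : Chat = ![(1/2)*x₁ + (1/2)*x₄ + (-y₁ + 2*y₂ - y₄)/(2*Real.sqrt 3),
                (1/2)*y₁ + (1/2)*y₄ + (x₁ - 2*x₂ + x₄)/(2*Real.sqrt 3)])
    (rhat : ℝ)
    (hrhat : rhat = Real.sqrt ((1/3) * ((r₁₂^2 + r₁₄^2 + r₂₄^2)/2 + Real.sqrt 3 * 𝔖₁₂₄)))
    (h : 0 < δ) (h1 : 0 < δ₁) (h2 : 0 < δ₂) (h3 : 0 < δ₃) (h4 : 0 < δ₄)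
    (hccw : 0 < 𝔖₁₂₄) :
    dist S₂ Chat = rhat := by
  have hs : Real.sqrt 3 ^ 2 = 3 := Real.sq_sqrt (by norm_num)
  have hs0 : Real.sqrt 3 ≠ 0 := by positivity
  have hD0 : D ≠ 0 := by
    intro h0
    obtain ⟨a1, a2⟩ := steiner_zero τ₁ τ₂ (hD.symm.trans h0)
    rw [hδ₃, hη₂, a1, a2] at h3
    simp at h3
  have dist_sq : ∀ P Q : EuclideanSpace ℝ (Fin 2),
      dist P Q = Real.sqrt ((P 0 - Q 0)^2 + (P 1 - Q 1)^2) := by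
    intro P Q
    rw [EuclideanSpace.dist_eq]
    simp [Fin.sum_univ_two, Real.dist_eq, sq_abs]
  have dist_sq' : ∀ P Q : EuclideanSpace ℝ (Fin 2),
      dist P Q ^ 2 = (P 0 - Q 0)^2 + (P 1 - Q 1)^2 := by
    intro P Q
    rw [dist_sq, Real.sq_sqrt (by positivity)]
  rw [hrhat, hr₁₂, hr₁₄, hr₂₄, dist_sq', dist_sq', dist_sq', dist_sq, hP₁, hP₂, hP₄, hS₂, hChat]
  congr 1
  simp only [Matrix.cons_val_zero, Matrix.cons_val_one]
  generalize Real.sqrt 3 = s at *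
  obtain ⟨Y₁, hY₁⟩ : ∃ Y, y₁ = s * Y := ⟨y₁ / s, by field_simp⟩
  obtain ⟨Y₂, hY₂⟩ : ∃ Y, y₂ = s * Y := ⟨y₂ / s, by field_simp⟩
  obtain ⟨Y₃, hY₃⟩ : ∃ Y, y₃ = s * Y := ⟨y₃ / s, by field_simp⟩
  obtain ⟨Y₄, hY₄⟩ : ∃ Y, y₄ = s * Y := ⟨y₄ / s, by field_simp⟩
  have inv : ∀ a : ℝ, a / s = s * (a / 3) := by
    intro a
    rw [div_eq_iff hs0]
    linear_combination (-a / 3) * hs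
  obtain ⟨d, hd⟩ : ∃ d, d = -(x₃ - x₄) * ((2*τ₁+τ₂)/3) + (Y₃ - Y₄) * τ₂ := ⟨_, rfl⟩
  have hδd : δ₃ = s * d := by
    rw [hδ₃, hη₂, inv, hd, hY₃, hY₄]; ring
  have key := steiner_key x₁ Y₁ x₂ Y₂ x₃ Y₃ x₄ Y₄ τ₁ τ₂ d D
    (by rw [hτ₁, hY₂, hY₄]; linear_combination (Y₂ - Y₄) * hs)
    (by rw [hτ₂, hY₃, hY₁]; linear_combination (Y₃ - Y₁) * hs) hd hD hD0
  have c1 : x₃ + s / 2 * (δ₃ * τ₁ / D) = x₃ + 3/2 * (d * τ₁ / D) := by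
    rw [hδd]; linear_combination (d * τ₁ / D / 2) * hs
  have c2 : y₃ + s / 2 * (δ₃ * η₁ / D) = s * (Y₃ + 3/2 * (d * (-(τ₁+2*τ₂)/3) / D)) := by
    rw [hδd, hη₁, inv, hY₃]
    linear_combination (s * d * (-(τ₁+2*τ₂)/3) / D / 2) * hs
  have c3 : (-y₁ + 2*y₂ - y₄)/(2*s) = (-Y₁ + 2*Y₂ - Y₄)/2 := by
    rw [hY₁, hY₂, hY₄]; field_simp
  have c4 : (x₁ - 2*x₂ + x₄)/(2*s) = s * ((x₁ - 2*x₂ + x₄)/6) := by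
    rw [← div_div, inv]; ring
  rw [c1, c2, c3, c4, h𝔖, hY₁, hY₂, hY₄]
  generalize x₃ + 3/2 * (d * τ₁ / D) = U at *
  generalize Y₃ + 3/2 * (d * (-(τ₁+2*τ₂)/3) / D) = V at *
  linear_combination key + ((V - ((1/2)*Y₁ + (1/2)*Y₄ + (x₁ - 2*x₂ + x₄)/6))^2
    - (1/3) * (((Y₁-Y₂)^2 + (Y₁-Y₄)^2 + (Y₂-Y₄)^2)/2
      + ((x₂ - x₁)*(Y₄ - Y₁) - (x₄ - x₁)*(Y₂ - Y₁)))) * hs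
end

section
/- Assume 𝔖₁₂₄ > 0. Then Ĉ is the circumcenter of the equilateral triangle built on the segment Q₁P₄: |Ĉ − Q₁| = r̂, |Ĉ − P₄| = r̂, and |Q₁ − P₄| = √3·r̂. Moreover, if P₂ ≠ P₄, the point I = (x₁ + (𝔖₁₂₄/(√3·r₂₄²))·(√3(y₄ − y₂) + x₂ − x₄), y₁ + (𝔖₁₂₄/(√3·r₂₄²))·(√3(x₂ − x₄) + y₂ − y₄)) satisfies |I − Ĉ| = r̂, |I − C| = r₁₂/√3, and I lies on the line through P₂ and P₄ (the points I, P₂, P₄ are collinear). -/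
/-- The circle `𝔥C` (centered at `Chat`, radius `rhat`) circumscribes the equilateral triangle
built on the segment `Q₁P₄`, and passes through the intersection point `I` of the circle `𝔠`
(centered at `C`, radius `r₁₂/√3`) with the diagonal `P₂P₄`. -/
theorem circumcircle_of_Q1P4_and_intersection_point
    (x₁ y₁ x₂ y₂ x₄ y₄ : ℝ)
    (P₁ P₂ P₄ : EuclideanSpace ℝ (Fin 2))
    (hP₁ : P₁ = ![x₁, y₁]) (hP₂ : P₂ = ![x₂, y₂]) (hP₄ : P₄ = ![x₄, y₄])
    (r₁₂ r₁₄ r₂₄ : ℝ)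
    (hr₁₂ : r₁₂ = dist P₁ P₂) (hr₁₄ : r₁₄ = dist P₁ P₄) (hr₂₄ : r₂₄ = dist P₂ P₄)
    (Q₁ C : EuclideanSpace ℝ (Fin 2))
    (hQ₁ : Q₁ = ![(1/2)*x₁ + (1/2)*x₂ - Real.sqrt 3 / 2 * y₁ + Real.sqrt 3 / 2 * y₂,
                  Real.sqrt 3 / 2 * x₁ - Real.sqrt 3 / 2 * x₂ + (1/2)*y₁ + (1/2)*y₂])
    (hC : C = ![(1/2)*x₁ + (1/2)*x₂ - y₁/(2*Real.sqrt 3) + y₂/(2*Real.sqrt 3),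
                x₁/(2*Real.sqrt 3) - x₂/(2*Real.sqrt 3) + (1/2)*y₁ + (1/2)*y₂])
    (𝔖₁₂₄ : ℝ) (h𝔖 : 𝔖₁₂₄ = (x₂ - x₁)*(y₄ - y₁) - (x₄ - x₁)*(y₂ - y₁))
    (hccw : 0 < 𝔖₁₂₄)
    (Chat : EuclideanSpace ℝ (Fin 2))
    (hChat : Chat = ![(1/2)*x₁ + (1/2)*x₄ + (-y₁ + 2*y₂ - y₄)/(2*Real.sqrt 3),
                      (1/2)*y₁ + (1/2)*y₄ + (x₁ - 2*x₂ + x₄)/(2*Real.sqrt 3)])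
    (rhat : ℝ)
    (hrhat : rhat = Real.sqrt ((1/3) * ((r₁₂^2 + r₁₄^2 + r₂₄^2)/2 + Real.sqrt 3 * 𝔖₁₂₄)))
    (I : EuclideanSpace ℝ (Fin 2))
    (hI : I = ![x₁ + 𝔖₁₂₄ / (Real.sqrt 3 * r₂₄^2) * (Real.sqrt 3 * (y₄ - y₂) + x₂ - x₄),
                y₁ + 𝔖₁₂₄ / (Real.sqrt 3 * r₂₄^2) * (Real.sqrt 3 * (x₂ - x₄) + y₂ - y₄)]) :
    dist Chat Q₁ = rhat ∧ dist Chat P₄ = rhat ∧ dist Q₁ P₄ = Real.sqrt 3 * rhat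
    ∧ (P₂ ≠ P₄ →
        dist I Chat = rhat ∧ dist I C = r₁₂ / Real.sqrt 3
        ∧ Collinear ℝ ({I, P₂, P₄} : Set (EuclideanSpace ℝ (Fin 2)))) := by
  have h3 : Real.sqrt 3 ^ 2 = 3 := Real.sq_sqrt (by norm_num)
  have hpos : 0 < Real.sqrt 3 := Real.sqrt_pos.mpr (by norm_num)
  have hinv : ∀ z : ℝ, z / (2 * Real.sqrt 3) = z * Real.sqrt 3 / 6 := by
    intro z
    field_simp
    linear_combination (-2 * z) * h3
  simp only [hinv] at hC hChat
  have c0 : ∀ {P : EuclideanSpace ℝ (Fin 2)} {a b : ℝ}, P.ofLp = ![a, b] → P 0 = a ∧ P 1 = b := by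
    intro P a b h
    simp [h]
  obtain ⟨p10, p11⟩ := c0 hP₁
  obtain ⟨p20, p21⟩ := c0 hP₂
  obtain ⟨p40, p41⟩ := c0 hP₄
  obtain ⟨q0, q1⟩ := c0 hQ₁
  obtain ⟨e0, e1⟩ := c0 hC
  obtain ⟨d0, d1⟩ := c0 hChat
  obtain ⟨i0, i1⟩ := c0 hI
  have hd : ∀ A B : EuclideanSpace ℝ (Fin 2),
      dist A B ^ 2 = (A 0 - B 0) ^ 2 + (A 1 - B 1) ^ 2 := by
    intro A B
    rw [EuclideanSpace.dist_sq_eq, Fin.sum_univ_two, Real.dist_eq, Real.dist_eq, sq_abs, sq_abs]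
  have R12 : r₁₂ ^ 2 = (x₁ - x₂) ^ 2 + (y₁ - y₂) ^ 2 := by rw [hr₁₂, hd, p10, p11, p20, p21]
  have R14 : r₁₄ ^ 2 = (x₁ - x₄) ^ 2 + (y₁ - y₄) ^ 2 := by rw [hr₁₄, hd, p10, p11, p40, p41]
  have R24 : r₂₄ ^ 2 = (x₂ - x₄) ^ 2 + (y₂ - y₄) ^ 2 := by rw [hr₂₄, hd, p20, p21, p40, p41]
  have h12 : 0 ≤ r₁₂ := by rw [hr₁₂]; exact dist_nonneg
  have hr0 : 0 ≤ rhat := by rw [hrhat]; exact Real.sqrt_nonneg _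
  have hr2 : rhat ^ 2 = (1/3) * ((r₁₂^2 + r₁₄^2 + r₂₄^2)/2 + Real.sqrt 3 * 𝔖₁₂₄) := by
    rw [hrhat]; exact Real.sq_sqrt (by positivity)
  rw [R12, R14, R24] at hr2
  have key : ∀ (A B : EuclideanSpace ℝ (Fin 2)) (r : ℝ), 0 ≤ r →
      (A 0 - B 0) ^ 2 + (A 1 - B 1) ^ 2 = r ^ 2 → dist A B = r := by
    intro A B r hr h
    rw [← hd] at h
    exact (pow_left_inj₀ dist_nonneg hr two_ne_zero).mp h
  generalize Real.sqrt 3 = s at *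
  refine ⟨key _ _ _ hr0 ?_, key _ _ _ hr0 ?_, key _ _ _ (by positivity) ?_, ?_⟩
  · rw [d0, d1, q0, q1, hr2, h𝔖]
    linear_combination ((1/36) * ((2*x₁-x₂-x₄)^2 + (2*y₁-y₂-y₄)^2)) * h3
  · rw [d0, d1, p40, p41, hr2, h𝔖]
    linear_combination ((1/36) * ((x₁-2*x₂+x₄)^2 + (y₁-2*y₂+y₄)^2)) * h3
  · rw [mul_pow, q0, q1, p40, p41, hr2, h𝔖, h3]
    linear_combination ((1/4) * ((x₁-x₂)^2 + (y₁-y₂)^2)) * h3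
  intro hne
  have hR : 0 < r₂₄ := by rw [hr₂₄]; exact dist_pos.mpr hne
  obtain ⟨t, ht⟩ : ∃ t, t = 𝔖₁₂₄ / (3 * r₂₄ ^ 2) := ⟨_, rfl⟩
  have hst : 𝔖₁₂₄ / (s * r₂₄ ^ 2) = s * t := by
    rw [ht]; field_simp; linear_combination -h3
  have htR : 3 * t * ((x₂ - x₄) ^ 2 + (y₂ - y₄) ^ 2) = (x₂ - x₁)*(y₄ - y₁) - (x₄ - x₁)*(y₂ - y₁) := by
    rw [← h𝔖, ← R24, ht]; field_simp
  rw [hst] at i0 i1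
  have j0 : I 0 = x₁ + t * (3 * (y₄ - y₂) + s * (x₂ - x₄)) := by
    rw [i0]; linear_combination t * (y₄ - y₂) * h3
  have j1 : I 1 = y₁ + t * (3 * (x₂ - x₄) + s * (y₂ - y₄)) := by
    rw [i1]; linear_combination t * (x₂ - x₄) * h3
  refine ⟨key _ _ _ hr0 ?_, key _ _ _ (by positivity) ?_, ?_⟩
  · rw [j0, j1, d0, d1, hr2, h𝔖]
    linear_combination (4*t + 2*s/3) * htR + ((t*(x₂-x₄) - (-y₁+2*y₂-y₄)/6)^2 + (t*(y₂-y₄) - (x₁-2*x₂+x₄)/6)^2) * h3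
  · rw [div_pow, h3, R12, j0, j1, e0, e1]
    linear_combination (4*t) * htR + ((t*(x₂-x₄) + (y₁-y₂)/6)^2 + (t*(y₂-y₄) - (x₁-x₂)/6)^2) * h3
  · have hRpos : 0 < (x₂ - x₄) ^ 2 + (y₂ - y₄) ^ 2 := by rw [← R24]; positivity
    obtain ⟨m, hm⟩ : ∃ m, m * ((x₂ - x₄) ^ 2 + (y₂ - y₄) ^ 2)
        = (x₁ - x₂) * (x₂ - x₄) + (y₁ - y₂) * (y₂ - y₄) :=
      ⟨_, div_mul_cancel₀ _ hRpos.ne'⟩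
    have k0 : x₁ - x₂ + 3 * t * (y₄ - y₂) = m * (x₂ - x₄) := by
      apply mul_right_cancel₀ hRpos.ne'
      linear_combination (y₄ - y₂) * htR - (x₂ - x₄) * hm
    have k1 : y₁ - y₂ + 3 * t * (x₂ - x₄) = m * (y₂ - y₄) := by
      apply mul_right_cancel₀ hRpos.ne'
      linear_combination (x₂ - x₄) * htR - (y₂ - y₄) * hm
    rw [collinear_iff_of_mem (p₀ := P₂) (by simp)]
    refine ⟨P₂ - P₄, ?_⟩
    intro p hp
    simp only [Set.mem_insert_iff, Set.mem_singleton_iff] at hp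
    rcases hp with rfl | rfl | rfl
    · refine ⟨m + t * s, ?_⟩
      ext i
      fin_cases i
      · simp [j0, p20, p40]
        linear_combination k0
      · simp [j1, p21, p41]
        linear_combination k1
    · exact ⟨0, by simp⟩
    · exact ⟨-1, by simp⟩
end
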